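/- For every μ > 0, every a > 0, every r ∈ S² and every ω ∈ ℝ³, the single-layer potential of the rescaled Stokeslet applied to the rotation density s ↦ ω × s satisfies ∫_{S²} G(a(r − s)) (ω × s) dσ(s) = (1/(3μa)) (ω × r). (Equivalently: rotations are eigenfunctions of the single-layer operator f ↦ ∫_{S²} G(a(· − s)) f(s) dσ(s) with eigenvalue 1/(3μa), i.e. eigenvalue 3μa for its inverse.) -/

import Mathlib

open MeasureTheory Metric

/-- The Stokeslet `G(r) = (1/(8πμ))(Id/|r| + r⊗r/|r|³)` as a 3×3 matrix, on
`EuclideanSpace ℝ (Fin 3)` (so `‖·‖` is the Euclidean norm). -/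
noncomputable def stokeslet (μ : ℝ) (r : EuclideanSpace ℝ (Fin 3)) :
    Matrix (Fin 3) (Fin 3) ℝ :=
  fun i j => (1 / (8 * Real.pi * μ)) *
    ((if i = j then (1 : ℝ) else 0) / ‖r‖ + r i * r j / ‖r‖ ^ 3)

/-- The surface measure `σ` on the unit sphere `S² ⊆ ℝ³` (total mass `4π`). -/
noncomputable def sphereMeasure : Measure (sphere (0 : EuclideanSpace ℝ (Fin 3)) 1) :=
  (volume : Measure (EuclideanSpace ℝ (Fin 3))).toSphere


abbrev E3 := EuclideanSpace ℝ (Fin 3)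

noncomputable def sphParam (b : OrthonormalBasis (Fin 3) ℝ E3) (p : ℝ × ℝ) : E3 :=
  Real.cos p.1 • b 0 + (Real.sin p.1 * Real.cos p.2) • b 1 + (Real.sin p.1 * Real.sin p.2) • b 2

noncomputable def coordMap (b : OrthonormalBasis (Fin 3) ℝ E3) (q : ℝ × (ℝ × ℝ)) : E3 :=
  q.1 • b 0 + q.2.1 • b 1 + q.2.2 • b 2

lemma measurePreserving_coordMap (b : OrthonormalBasis (Fin 3) ℝ E3) :
    MeasurePreserving (coordMap b) volume volume := by
  have h1 := (volume_preserving_finTwoArrow ℝ).symm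
  have h2 := (volume_preserving_piFinSuccAbove (fun _ : Fin 3 => ℝ) 0).symm
  have h3 := PiLp.volume_preserving_toLp (Fin 3)
  have h4 := b.measurePreserving_repr_symm
  have h0 : MeasurePreserving (Prod.map (id : ℝ → ℝ) (MeasurableEquiv.finTwoArrow (α := ℝ)).symm)
    volume volume := (MeasurePreserving.id volume).prod h1
  have := h4.comp (h3.comp (h2.comp h0))
  convert this using 1
  ext1 ⟨z, x, y⟩
  simp only [Function.comp, coordMap, Prod.map]
  rw [← b.sum_repr (b.repr.symm _)]
  simp only [Fin.sum_univ_three, LinearIsometryEquiv.apply_symm_apply]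
  rfl

lemma norm_coordMap_sq (b : OrthonormalBasis (Fin 3) ℝ E3) (z x y : ℝ) :
    ‖coordMap b (z, x, y)‖ ^ 2 = z ^ 2 + x ^ 2 + y ^ 2 := by
  have h := b.orthonormal
  have e : ∀ i j, inner ℝ (b i) (b j) = if i = j then (1:ℝ) else 0 := fun i j =>
    orthonormal_iff_ite.1 h i j
  rw [← real_inner_self_eq_norm_sq]
  simp only [coordMap, inner_add_left, inner_add_right, real_inner_smul_left,
    real_inner_smul_right, e]
  simp
  ring

lemma norm_sphParam (b : OrthonormalBasis (Fin 3) ℝ E3) (p : ℝ × ℝ) : ‖sphParam b p‖ = 1 := by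
  have := norm_coordMap_sq b (Real.cos p.1) (Real.sin p.1 * Real.cos p.2)
    (Real.sin p.1 * Real.sin p.2)
  have h2 : ‖sphParam b p‖ ^ 2 = 1 := by
    have e : sphParam b p = coordMap b (Real.cos p.1, Real.sin p.1 * Real.cos p.2,
      Real.sin p.1 * Real.sin p.2) := by simp only [sphParam, coordMap]
    rw [e, this]
    have h1 := Real.sin_sq_add_cos_sq p.1
    have h2 := Real.sin_sq_add_cos_sq p.2
    linear_combination (Real.sin p.1)^2 * h2 + h1
  exact (pow_eq_one_iff_of_nonneg (norm_nonneg _) two_ne_zero).1 h2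

lemma continuous_sphParam (b : OrthonormalBasis (Fin 3) ℝ E3) : Continuous (sphParam b) := by
  unfold sphParam; fun_prop

lemma continuous_coordMap (b : OrthonormalBasis (Fin 3) ℝ E3) : Continuous (coordMap b) := by
  unfold coordMap; fun_prop

open scoped Pointwise in
lemma cone_eq (A : Set E3) :
    Set.Ioo (0 : ℝ) 1 • (Subtype.val '' (Subtype.val ⁻¹' A : Set (sphere (0 : E3) 1))) =
      {x | 0 < ‖x‖ ∧ ‖x‖ < 1 ∧ ‖x‖⁻¹ • x ∈ A} := by
  ext x
  constructor
  · rintro ⟨t, ht, _, ⟨s, hs, rfl⟩, rfl⟩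
    have h1 : ‖(s : E3)‖ = 1 := by simp
    have : ‖t • (s : E3)‖ = t := by rw [norm_smul, h1, mul_one, Real.norm_of_nonneg ht.1.le]
    change 0 < ‖t • (s : E3)‖ ∧ ‖t • (s : E3)‖ < 1 ∧ ‖t • (s : E3)‖⁻¹ • (t • (s : E3)) ∈ A
    rw [this]
    refine ⟨ht.1, ht.2, ?_⟩
    rw [smul_smul, inv_mul_cancel₀ ht.1.ne', one_smul]
    exact hs
  · rintro ⟨h0, h1, h2⟩
    refine ⟨‖x‖, ⟨h0, h1⟩, ‖x‖⁻¹ • x, ⟨⟨‖x‖⁻¹ • x, ?_⟩, h2, rfl⟩, ?_⟩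
    · simp [norm_smul, h0.ne']
    · simp only [smul_smul, mul_inv_cancel₀ h0.ne', one_smul]

noncomputable def paramMeasure : Measure (ℝ × ℝ) :=
  ((volume.restrict (Set.Ioo (-Real.pi) Real.pi)).prod
    (volume.restrict (Set.Ioo (-Real.pi) Real.pi))).withDensity
      (fun p => ENNReal.ofReal (Real.sin p.1))

lemma radial : ∫⁻ R in Set.Ioi (0:ℝ), ENNReal.ofReal R * ENNReal.ofReal R *
    (if R < 1 then 1 else 0) = 3⁻¹ := by
  have : ∀ R : ℝ, ENNReal.ofReal R * ENNReal.ofReal R * (if R < 1 then 1 else 0) =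
      (Set.Iio (1:ℝ)).indicator (fun R => ENNReal.ofReal R * ENNReal.ofReal R) R := by
    intro R
    by_cases h : R < 1 <;> simp [h]
  simp_rw [this]
  rw [lintegral_indicator measurableSet_Iio, Measure.restrict_restrict measurableSet_Iio,
    Set.Iio_inter_Ioi]
  have : ∫⁻ R in Set.Ioo (0:ℝ) 1, ENNReal.ofReal R * ENNReal.ofReal R =
      ∫⁻ R in Set.Ioc (0:ℝ) 1, ENNReal.ofReal (R ^ 2) := by
    rw [Measure.restrict_congr_set Ioo_ae_eq_Ioc]
    refine setLIntegral_congr_fun measurableSet_Ioc fun x hx => ?_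
    rw [← ENNReal.ofReal_mul hx.1.le, sq]
  rw [this, ← ofReal_integral_eq_lintegral_ofReal (intervalIntegral.intervalIntegrable_pow _).1,
    ← intervalIntegral.integral_of_le zero_le_one]
  · simp only [integral_pow]
    norm_num
    rw [one_div, ENNReal.ofReal_inv_of_pos (by norm_num)]
    simp
  · filter_upwards with y
    positivity

lemma map_sphere (b : OrthonormalBasis (Fin 3) ℝ E3) :
    ((volume : Measure E3).toSphere).map (↑) = paramMeasure.map (sphParam b) := by
  ext A hA
  have hAi : Measurable (A.indicator (fun _ => (1 : ENNReal))) := measurable_const.indicator hA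
  have hu : Measurable (sphParam b) := (continuous_sphParam b).measurable
  have hc : Measurable (coordMap b) := (continuous_coordMap b).measurable
  rw [Measure.map_apply measurable_subtype_coe hA, Measure.map_apply hu hA,
    Measure.toSphere_apply' _ (measurable_subtype_coe hA), cone_eq]
  set C : Set E3 := {x | 0 < ‖x‖ ∧ ‖x‖ < 1 ∧ ‖x‖⁻¹ • x ∈ A} with hC
  have hCm : MeasurableSet C := by
    refine MeasurableSet.inter (measurableSet_lt measurable_const measurable_norm)
      (MeasurableSet.inter (measurableSet_lt measurable_norm measurable_const) ?_)
    have : Measurable fun x : E3 => ‖x‖⁻¹ • x := by fun_prop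
    exact this hA
  set K : E3 → ENNReal := C.indicator (fun _ => 1) with hK
  have hKm : Measurable K := measurable_const.indicator hCm
  -- the cone volume in coordinates
  have key : volume C = 3⁻¹ * paramMeasure (sphParam b ⁻¹' A) := by
    calc volume C = ∫⁻ x, K x := (lintegral_indicator_one hCm).symm
      _ = ∫⁻ q : ℝ × (ℝ × ℝ), K (coordMap b q) :=
        ((measurePreserving_coordMap b).lintegral_comp hKm).symm
      _ = ∫⁻ z : ℝ, ∫⁻ w : ℝ × ℝ, K (coordMap b (z, w)) := by
        exact lintegral_prod _ (hKm.comp hc).aemeasurable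
      _ = ∫⁻ z : ℝ, ∫⁻ φ in Set.Ioo (-Real.pi) Real.pi, ∫⁻ ρ in Set.Ioi (0:ℝ),
            ENNReal.ofReal ρ * K (coordMap b (z, ρ * Real.cos φ, ρ * Real.sin φ)) := by
        refine lintegral_congr fun z => ?_
        rw [← lintegral_comp_polarCoord_symm, polarCoord_target, Measure.volume_eq_prod,
          ← Measure.prod_restrict, lintegral_prod_symm]
        · rfl
        · refine Measurable.aemeasurable ?_
          refine Measurable.mul (by fun_prop) (hKm.comp (hc.comp ?_))
          exact measurable_const.prodMk continuous_polarCoord_symm.measurable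
      _ = ∫⁻ φ in Set.Ioo (-Real.pi) Real.pi, ∫⁻ z : ℝ, ∫⁻ ρ in Set.Ioi (0:ℝ),
            ENNReal.ofReal ρ * K (coordMap b (z, ρ * Real.cos φ, ρ * Real.sin φ)) := by
        rw [lintegral_lintegral_swap]
        refine Measurable.aemeasurable ?_
        refine Measurable.lintegral_prod_right' (f := fun p : (ℝ × ℝ) × ℝ => ENNReal.ofReal p.2 *
          K (coordMap b (p.1.1, p.2 * Real.cos p.1.2, p.2 * Real.sin p.1.2))) ?_
        refine Measurable.mul (by fun_prop) (hKm.comp (hc.comp ?_))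
        fun_prop
      _ = ∫⁻ φ in Set.Ioo (-Real.pi) Real.pi, ∫⁻ w : ℝ × ℝ,
            ENNReal.ofReal w.2 * K (coordMap b (w.1, w.2 * Real.cos φ, w.2 * Real.sin φ)) := by
        refine lintegral_congr fun φ => ?_
        rw [Measure.volume_eq_prod, lintegral_prod]
        · refine lintegral_congr fun z => ?_
          rw [← lintegral_indicator measurableSet_Ioi]
          refine lintegral_congr fun ρ => ?_
          by_cases h : 0 < ρ
          · simp [Set.indicator, h]
          · simp [Set.indicator, h, ENNReal.ofReal_of_nonpos (not_lt.1 h)]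
        · refine Measurable.aemeasurable ?_
          refine Measurable.mul (by fun_prop) (hKm.comp (hc.comp ?_))
          fun_prop
      _ = ∫⁻ φ in Set.Ioo (-Real.pi) Real.pi, ∫⁻ θ in Set.Ioo (-Real.pi) Real.pi,
           ∫⁻ R in Set.Ioi (0:ℝ), (ENNReal.ofReal R * ENNReal.ofReal R *
              (if R < 1 then 1 else 0)) *
             (ENNReal.ofReal (Real.sin θ) * A.indicator (fun _ => 1) (sphParam b (θ, φ))) := by
        refine lintegral_congr fun φ => ?_
        rw [← lintegral_comp_polarCoord_symm, polarCoord_target, Measure.volume_eq_prod,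
          ← Measure.prod_restrict, lintegral_prod_symm]
        · refine lintegral_congr fun θ => ?_
          refine setLIntegral_congr_fun measurableSet_Ioi fun R hR => ?_
          have hR : 0 < R := hR
          have e1 : coordMap b (R * Real.cos θ, R * Real.sin θ * Real.cos φ,
              R * Real.sin θ * Real.sin φ) = R • sphParam b (θ, φ) := by
            simp only [coordMap, sphParam, smul_add, smul_smul, mul_assoc]
          have e2 : ‖R • sphParam b (θ, φ)‖ = R := by
            rw [norm_smul, norm_sphParam, mul_one, Real.norm_of_nonneg hR.le]
          have e3 : K (R • sphParam b (θ, φ)) = (if R < 1 then 1 else 0) *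
              A.indicator (fun _ => 1) (sphParam b (θ, φ)) := by
            have hmem : R • sphParam b (θ, φ) ∈ C ↔ R < 1 ∧ sphParam b (θ, φ) ∈ A := by
              change 0 < ‖R • sphParam b (θ, φ)‖ ∧ ‖R • sphParam b (θ, φ)‖ < 1 ∧
                ‖R • sphParam b (θ, φ)‖⁻¹ • (R • sphParam b (θ, φ)) ∈ A ↔ _
              rw [e2, smul_smul, inv_mul_cancel₀ hR.ne', one_smul]
              simp [hR]
            by_cases h1 : R < 1 <;> by_cases h2 : sphParam b (θ, φ) ∈ A <;>
              simp [hK, Set.indicator, hmem, h1, h2]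
          simp only [polarCoord_symm_apply, smul_eq_mul, e1, e3]
          rw [ENNReal.ofReal_mul hR.le]
          ring
        · refine Measurable.aemeasurable ?_
          refine Measurable.mul (by fun_prop) ?_
          simp only [polarCoord_symm_apply]
          refine Measurable.mul (by fun_prop) (hKm.comp (hc.comp ?_))
          fun_prop
      _ = ∫⁻ φ in Set.Ioo (-Real.pi) Real.pi, ∫⁻ θ in Set.Ioo (-Real.pi) Real.pi, 3⁻¹ *
             (ENNReal.ofReal (Real.sin θ) * A.indicator (fun _ => 1) (sphParam b (θ, φ))) := by
        refine lintegral_congr fun φ => lintegral_congr fun θ => ?_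
        rw [lintegral_mul_const _ ?_, radial]
        refine Measurable.mul (by fun_prop) (Measurable.ite measurableSet_Iio (by fun_prop)
          (by fun_prop))
      _ = 3⁻¹ * paramMeasure (sphParam b ⁻¹' A) := by
        have hm : Measurable fun p : ℝ × ℝ => (ENNReal.ofReal (Real.sin p.1) *
            A.indicator (fun _ => 1) (sphParam b p)) :=
          Measurable.mul (by fun_prop) (hAi.comp hu)
        rw [paramMeasure, withDensity_apply _ (hu hA), ← lintegral_indicator (hu hA),
          ← lintegral_const_mul _ (by exact Measurable.indicator (by fun_prop) (hu hA)),
          lintegral_prod_symm]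
        · refine lintegral_congr fun φ => lintegral_congr fun θ => ?_
          congr 1
          by_cases h : sphParam b (θ, φ) ∈ A
          · rw [Set.indicator_of_mem h, Set.indicator_of_mem (show (θ, φ) ∈ sphParam b ⁻¹' A from h),
              mul_one]
          · rw [Set.indicator_of_notMem h,
              Set.indicator_of_notMem (show (θ, φ) ∉ sphParam b ⁻¹' A from h), mul_zero]
        · exact (Measurable.const_mul (Measurable.indicator (by fun_prop) (hu hA)) _).aemeasurable
  rw [key, ← mul_assoc]
  simp
  rw [ENNReal.mul_inv_cancel (by simp) (by simp), one_mul]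

lemma sphere_integral (b : OrthonormalBasis (Fin 3) ℝ E3) (F : E3 → Fin 3 → ℝ)
    (hF : Measurable F) :
    ∫ s : sphere (0 : E3) 1, F s ∂(volume : Measure E3).toSphere =
      ∫ p in Set.Ioo 0 Real.pi ×ˢ Set.Ioo (-Real.pi) Real.pi,
        Real.sin p.1 • F (sphParam b p) := by
  have h1 := (MeasurableEmbedding.subtype_coe
    (isClosed_sphere (x := (0 : E3)) (ε := 1)).measurableSet).integral_map
      (μ := (volume : Measure E3).toSphere) F
  rw [← h1, map_sphere b, integral_map (continuous_sphParam b).measurable.aemeasurable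
    hF.aestronglyMeasurable, paramMeasure, integral_withDensity_eq_integral_toReal_smul
    (by fun_prop) (by simp), Measure.prod_restrict, ← Measure.volume_eq_prod]
  have hsub : Set.Ioo 0 Real.pi ×ˢ Set.Ioo (-Real.pi) Real.pi ⊆
      Set.Ioo (-Real.pi) Real.pi ×ˢ Set.Ioo (-Real.pi) Real.pi :=
    Set.prod_mono (Set.Ioo_subset_Ioo_left (by linarith [Real.pi_pos])) le_rfl
  refine (setIntegral_eq_of_subset_of_forall_sdiff_eq_zero
    (measurableSet_Ioo.prod measurableSet_Ioo) hsub ?_).trans ?_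
  rotate_left
  · refine setIntegral_congr_fun (measurableSet_Ioo.prod measurableSet_Ioo) fun p hp => ?_
    beta_reduce
    rw [ENNReal.toReal_ofReal (Real.sin_pos_of_pos_of_lt_pi hp.1.1 hp.1.2).le]
  · rintro ⟨x, y⟩ ⟨hp, hn⟩
    have hx : x ≤ 0 := by
      by_contra h
      exact hn ⟨⟨not_le.1 h, hp.1.2⟩, hp.2⟩
    have : Real.sin x ≤ 0 := Real.sin_nonpos_of_nonpos_of_neg_pi_le hx hp.1.1.le
    simp [ENNReal.ofReal_of_nonpos this]

/-- The desingularised integrand. -/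
noncomputable def smoothP (C N1 N2 r p q k1 k2 : ℝ) (x : ℝ × ℝ) : ℝ :=
  Real.cos (x.1 / 2) * (Real.cos x.1 * C + Real.sin x.1 * (Real.cos x.2 * N1 + Real.sin x.2 * N2)
    + 1 / 2 * Real.sin x.1 * r * (Real.cos x.2 * k1 + Real.sin x.2 * k2)
    - Real.cos (x.1 / 2) ^ 2 * (Real.cos x.2 * p + Real.sin x.2 * q) *
      (Real.cos x.2 * k1 + Real.sin x.2 * k2))

lemma continuous_smoothP (C N1 N2 r p q k1 k2 : ℝ) :
    Continuous (smoothP C N1 N2 r p q k1 k2) := by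
  unfold smoothP; fun_prop

lemma integrableOn_rect {F : Type*} [NormedAddCommGroup F] (f : ℝ × ℝ → F) (hf : Continuous f) :
    IntegrableOn f (Set.Ioo 0 Real.pi ×ˢ Set.Ioo (-Real.pi) Real.pi) :=
  (hf.continuousOn.integrableOn_compact
    (isCompact_Icc.prod isCompact_Icc : IsCompact (Set.Icc 0 Real.pi ×ˢ Set.Icc (-Real.pi) Real.pi))).mono_set
    (Set.prod_mono Set.Ioo_subset_Icc_self Set.Ioo_subset_Icc_self)

lemma integral_smoothP (C N1 N2 r p q k1 k2 : ℝ) :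
    ∫ x in Set.Ioo 0 Real.pi ×ˢ Set.Ioo (-Real.pi) Real.pi, smoothP C N1 N2 r p q k1 k2 x =
      4 * Real.pi / 3 * (C - (p * k1 + q * k2)) := by
  have hi := integrableOn_rect _ (continuous_smoothP C N1 N2 r p q k1 k2)
  rw [Measure.volume_eq_prod] at hi ⊢
  rw [setIntegral_prod _ hi]
  have inner : ∀ θ : ℝ, ∫ φ in Set.Ioo (-Real.pi) Real.pi, smoothP C N1 N2 r p q k1 k2 (θ, φ) =
      2 * Real.pi * Real.cos (θ / 2) * Real.cos θ * C -
        Real.pi * Real.cos (θ / 2) ^ 3 * (p * k1 + q * k2) := by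
    intro θ
    rw [← integral_Ioc_eq_integral_Ioo,
      ← intervalIntegral.integral_of_le (by linarith [Real.pi_pos])]
    rw [intervalIntegral.integral_eq_sub_of_hasDerivAt (f := fun φ => Real.cos (θ / 2) *
      (Real.cos θ * C * φ + Real.sin θ * (Real.sin φ * N1 - Real.cos φ * N2)
      + 1 / 2 * Real.sin θ * r * (Real.sin φ * k1 - Real.cos φ * k2)
      - Real.cos (θ / 2) ^ 2 * (p * k1 * ((φ + Real.sin φ * Real.cos φ) / 2)
        + q * k2 * ((φ - Real.sin φ * Real.cos φ) / 2)
        + (p * k2 + q * k1) * (Real.sin φ ^ 2 / 2))))]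
    · simp
      ring
    · intro φ _
      have hs := Real.hasDerivAt_sin φ
      have hc := Real.hasDerivAt_cos φ
      have hid := hasDerivAt_id' φ
      have := (((((hid.const_mul (Real.cos θ * C)).add
        (((hs.mul_const N1).sub (hc.mul_const N2)).const_mul (Real.sin θ))).add
        (((hs.mul_const k1).sub (hc.mul_const k2)).const_mul (1 / 2 * Real.sin θ * r))).sub
        (((((hid.add (hs.mul hc)).div_const 2).const_mul (p * k1)).add
          (((hid.sub (hs.mul hc)).div_const 2).const_mul (q * k2))).add
          (((hs.pow 2).div_const 2).const_mul (p * k2 + q * k1)) |>.const_mul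
            (Real.cos (θ / 2) ^ 2))).const_mul (Real.cos (θ / 2)))
      refine this.congr_deriv ?_
      simp only [smoothP]
      have e := Real.sin_sq_add_cos_sq φ
      have e2 : Real.sin φ ^ 2 = 1 - Real.cos φ ^ 2 := by linarith
      push_cast
      ring_nf
      rw [e2]
      ring
    · exact ((continuous_smoothP C N1 N2 r p q k1 k2).comp
        (continuous_const.prodMk continuous_id)).intervalIntegrable _ _
  simp_rw [inner]
  rw [← integral_Ioc_eq_integral_Ioo, ← intervalIntegral.integral_of_le Real.pi_pos.le]
  rw [intervalIntegral.integral_eq_sub_of_hasDerivAt (f := fun θ =>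
    2 * Real.pi * C * (2 * Real.sin (θ / 2) - 4 / 3 * Real.sin (θ / 2) ^ 3) -
      Real.pi * (p * k1 + q * k2) * (2 * Real.sin (θ / 2) - 2 / 3 * Real.sin (θ / 2) ^ 3))]
  · simp
    ring
  · intro θ _
    have hs := ((hasDerivAt_id' θ).div_const 2).sin
    have := (((hs.const_mul 2).sub ((hs.pow 3).const_mul (4 / 3))).const_mul (2 * Real.pi * C)).sub
      (((hs.const_mul 2).sub ((hs.pow 3).const_mul (2 / 3))).const_mul
        (Real.pi * (p * k1 + q * k2)))
    refine this.congr_deriv ?_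
    have e2 : Real.sin (θ / 2) ^ 2 = 1 - Real.cos (θ / 2) ^ 2 := by
      linarith [Real.sin_sq_add_cos_sq (θ / 2)]
    have e3 : Real.cos θ = 2 * Real.cos (θ / 2) ^ 2 - 1 := by
      rw [← Real.cos_two_mul]; congr 1; ring
    rw [e3]
    push_cast
    ring_nf
    ring_nf at e2 ⊢
    rw [e2]
    ring
  · exact Continuous.intervalIntegrable (by fun_prop) _ _

lemma basis_cross (b : OrthonormalBasis (Fin 3) ℝ E3) (ω : Fin 3 → ℝ) (i : Fin 3) :
    b 1 i * (∑ j, b 0 j * crossProduct ω (fun k => b 1 k) j) +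
      b 2 i * (∑ j, b 0 j * crossProduct ω (fun k => b 2 k) j) =
      - crossProduct ω (fun k => b 0 k) i := by
  set v : E3 := WithLp.toLp 2 (crossProduct (fun k => b 0 k) ω) with hv
  have h := congrArg (fun x : E3 => x i) (b.sum_repr' v)
  have hk : ∀ m, inner ℝ (b m) v = ∑ j, b 0 j * crossProduct ω (fun k => b m k) j := by
    intro m
    simp [PiLp.inner_apply, hv, Fin.sum_univ_three, cross_apply]
    ring
  have h0 : inner ℝ (b 0) v = 0 := by
    rw [hk]; simp [Fin.sum_univ_three, cross_apply]; ring
  simp only [Fin.sum_univ_three (fun i => inner ℝ (b i) v • b i), h0] at h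
  rw [hk, hk] at h
  simp only [PiLp.add_apply, PiLp.smul_apply, smul_eq_mul, zero_mul, zero_add] at h
  have hv' : v i = - crossProduct ω (fun k => b 0 k) i := by
    rw [hv, ← cross_anticomm]; rfl
  rw [← hv', ← h]
  ring

lemma pointwise (b : OrthonormalBasis (Fin 3) ℝ E3) (μ a : ℝ) (hμ : 0 < μ) (ha : 0 < a)
    (ω : Fin 3 → ℝ)
    (θ φ : ℝ) (h0 : 0 < θ) (hπ : θ < Real.pi) (i : Fin 3) :
    Real.sin θ * (stokeslet μ (a • (b 0 - sphParam b (θ, φ)))).mulVec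
      (crossProduct ω (fun i => (sphParam b (θ, φ)) i)) i =
    1 / (8 * Real.pi * μ * a) * smoothP (crossProduct ω (fun k => b 0 k) i)
      (crossProduct ω (fun k => b 1 k) i) (crossProduct ω (fun k => b 2 k) i)
      (b 0 i) (b 1 i) (b 2 i) (∑ j, b 0 j * crossProduct ω (fun k => b 1 k) j)
      (∑ j, b 0 j * crossProduct ω (fun k => b 2 k) j) (θ, φ) := by
  have hS : 0 < Real.sin (θ / 2) := Real.sin_pos_of_pos_of_lt_pi (by linarith) (by linarith)
  have hsin : Real.sin θ = 2 * Real.sin (θ / 2) * Real.cos (θ / 2) := by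
    rw [← Real.sin_two_mul]; congr 1; ring
  have hcos : Real.cos θ = 1 - 2 * Real.sin (θ / 2) ^ 2 := by
    have := Real.cos_two_mul (θ / 2)
    rw [show 2 * (θ / 2) = θ by ring] at this
    linarith [Real.sin_sq_add_cos_sq (θ / 2)]
  set S := Real.sin (θ / 2) with hSdef
  set c := Real.cos (θ / 2) with hcdef
  have hSc : S ^ 2 + c ^ 2 = 1 := Real.sin_sq_add_cos_sq (θ / 2)
  have hD : ‖b 0 - sphParam b (θ, φ)‖ = 2 * S := by
    have e : b 0 - sphParam b (θ, φ) = coordMap b (1 - Real.cos θ, - (Real.sin θ * Real.cos φ),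
        - (Real.sin θ * Real.sin φ)) := by
      simp only [sphParam, coordMap, sub_smul, neg_smul, one_smul]; abel
    have := norm_coordMap_sq b (1 - Real.cos θ) (- (Real.sin θ * Real.cos φ))
        (- (Real.sin θ * Real.sin φ))
    rw [← e] at this
    have h2 : ‖b 0 - sphParam b (θ, φ)‖ ^ 2 = (2 * S) ^ 2 := by
      rw [this, hsin, hcos]
      linear_combination 4 * S ^ 2 * c ^ 2 * (Real.sin_sq_add_cos_sq φ) + 4 * S ^ 2 * hSc
    exact (pow_left_inj₀ (norm_nonneg _) (by positivity) two_ne_zero).1 h2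
  have hDa : ‖a • (b 0 - sphParam b (θ, φ))‖ = a * (2 * S) := by
    rw [norm_smul, hD, Real.norm_of_nonneg ha.le]
  have hs : ∀ k, sphParam b (θ, φ) k = Real.cos θ * b 0 k + Real.sin θ * Real.cos φ * b 1 k
      + Real.sin θ * Real.sin φ * b 2 k := by
    intro k
    simp [sphParam]
  have hcr : ∀ k, crossProduct ω (fun i => (sphParam b (θ, φ)) i) k =
      Real.cos θ * crossProduct ω (fun k => b 0 k) k +
      Real.sin θ * Real.cos φ * crossProduct ω (fun k => b 1 k) k
      + Real.sin θ * Real.sin φ * crossProduct ω (fun k => b 2 k) k := by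
    have : (fun i => (sphParam b (θ, φ)) i) = Real.cos θ • (fun k => b 0 k) +
      (Real.sin θ * Real.cos φ) • (fun k => b 1 k) + (Real.sin θ * Real.sin φ) • (fun k => b 2 k) := by
      funext k; simp [hs]
    intro k
    rw [this]
    simp
  have hdot : ∑ j, (b 0 - sphParam b (θ, φ)) j *
      crossProduct ω (fun i => (sphParam b (θ, φ)) i) j =
      Real.sin θ * (Real.cos φ * (∑ j, b 0 j * crossProduct ω (fun k => b 1 k) j) +
       Real.sin φ * (∑ j, b 0 j * crossProduct ω (fun k => b 2 k) j)) := by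
    simp only [Fin.sum_univ_three, PiLp.sub_apply, hs, cross_apply]
    simp
    ring
  have hG : (stokeslet μ (a • (b 0 - sphParam b (θ, φ)))).mulVec
      (crossProduct ω (fun i => (sphParam b (θ, φ)) i)) i =
      1 / (8 * Real.pi * μ) * (crossProduct ω (fun i => (sphParam b (θ, φ)) i) i / (a * (2 * S)) +
        a ^ 2 * (b 0 - sphParam b (θ, φ)) i * (∑ j, (b 0 - sphParam b (θ, φ)) j *
      crossProduct ω (fun i => (sphParam b (θ, φ)) i) j) / (a * (2 * S)) ^ 3) := by
    generalize crossProduct ω (fun i => (sphParam b (θ, φ)) i) = w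
    simp only [Matrix.mulVec, dotProduct, stokeslet, hDa, PiLp.smul_apply, smul_eq_mul]
    generalize b 0 - sphParam b (θ, φ) = d
    fin_cases i <;> simp [Fin.sum_univ_three] <;> ring
  rw [hG, hdot, hcr, PiLp.sub_apply, hs, smoothP]
  simp only [← hcdef]
  generalize (∑ j, b 0 j * crossProduct ω (fun k => b 1 k) j) = k1
  generalize (∑ j, b 0 j * crossProduct ω (fun k => b 2 k) j) = k2
  generalize crossProduct ω (fun k => b 0 k) i = C0
  generalize crossProduct ω (fun k => b 1 k) i = C1
  generalize crossProduct ω (fun k => b 2 k) i = C2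
  have hpi := Real.pi_pos
  rw [hsin, hcos]
  field_simp
  ring

lemma exists_basis (r : E3) (hr : ‖r‖ = 1) : ∃ b : OrthonormalBasis (Fin 3) ℝ E3, b 0 = r := by
  obtain ⟨b, hb⟩ := Orthonormal.exists_orthonormalBasis_extension_of_card_eq (𝕜 := ℝ) (E := E3)
    (ι := Fin 3) (by simp) (v := fun _ => r) (s := {0}) (by
      constructor
      · intro i; simpa using hr
      · intro i j hij; exact absurd (Subsingleton.elim i j) hij)
  exact ⟨b, hb 0 rfl⟩

lemma measurable_integrand (μ a : ℝ) (r : E3) (ω : Fin 3 → ℝ) :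
    Measurable (fun s : E3 => (stokeslet μ (a • (r - s))).mulVec
          (crossProduct ω (fun i => s i))) := by
  refine measurable_pi_lambda _ fun i => ?_
  simp only [Matrix.mulVec, dotProduct, stokeslet, PiLp.smul_apply, smul_eq_mul]
  refine Finset.measurable_sum _ fun j _ => ?_
  refine Measurable.mul (by fun_prop) ?_
  fin_cases j <;> simp [cross_apply] <;> fun_prop

/-- Rotations are eigenfunctions of the single-layer operator of the rescaled
Stokeslet: for `μ > 0`, `a > 0`, `r ∈ S²` and `ω ∈ ℝ³`,
`∫_{S²} G(a(r − s)) (ω × s) dσ(s) = (1/(3μa)) (ω × r)`. -/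
theorem single_layer_rotation_eigenfunction (μ : ℝ) (hμ : 0 < μ) (a : ℝ) (ha : 0 < a)
    (r : EuclideanSpace ℝ (Fin 3)) (hr : ‖r‖ = 1) (ω : Fin 3 → ℝ) :
    (∫ s : sphere (0 : EuclideanSpace ℝ (Fin 3)) 1,
        (stokeslet μ (a • (r - (s : EuclideanSpace ℝ (Fin 3))))).mulVec
          (crossProduct ω (fun i => (s : EuclideanSpace ℝ (Fin 3)) i)) ∂sphereMeasure)
      = (1 / (3 * μ * a)) • crossProduct ω (fun i => r i) := by
  obtain ⟨b, rfl⟩ := exists_basis r hr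
  have h1 := sphere_integral b _ (measurable_integrand μ a (b 0) ω)
  rw [sphereMeasure, h1]
  set P : ℝ × ℝ → Fin 3 → ℝ := fun x i =>
    1 / (8 * Real.pi * μ * a) * smoothP (crossProduct ω (fun k => b 0 k) i)
      (crossProduct ω (fun k => b 1 k) i) (crossProduct ω (fun k => b 2 k) i)
      (b 0 i) (b 1 i) (b 2 i) (∑ j, b 0 j * crossProduct ω (fun k => b 1 k) j)
      (∑ j, b 0 j * crossProduct ω (fun k => b 2 k) j) x with hP
  have hPc : ∀ i, Continuous fun x => P x i := fun i =>
    continuous_const.mul (continuous_smoothP _ _ _ _ _ _ _ _)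
  have h2 : ∫ p in Set.Ioo 0 Real.pi ×ˢ Set.Ioo (-Real.pi) Real.pi,
        Real.sin p.1 • (stokeslet μ (a • (b 0 - sphParam b p))).mulVec
          (crossProduct ω (fun i => sphParam b p i)) =
      ∫ p in Set.Ioo 0 Real.pi ×ˢ Set.Ioo (-Real.pi) Real.pi, P p := by
    refine setIntegral_congr_fun (measurableSet_Ioo.prod measurableSet_Ioo) ?_
    rintro ⟨θ, φ⟩ hp
    funext i
    exact pointwise b μ a hμ ha ω θ φ hp.1.1 hp.1.2 i
  rw [h2]
  funext i
  rw [eval_integral (fun i => integrableOn_rect _ (hPc i))]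
  simp only [hP]
  rw [integral_const_mul, integral_smoothP, basis_cross, Pi.smul_apply, smul_eq_mul]
  have hpi := Real.pi_pos
  field_simp
  ring
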